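/- For every t, t' ∈ [0,T] and every continuous function ψ : (0,∞) × 𝒳 × (0,∞) → ℝ with ‖ψ‖_V < ∞, one has ‖B(t)ψ − B(t')ψ‖_V ≤ (sup_{z∈ℝ, i∈𝒳} |β₂(t,z,i) − β₂(t',z,i)|) · (3·ν(ℝ) + ∫_ℝ η dν) · ‖ψ‖_V, where (B(t)ψ)(s,i,y) := ∫_ℝ β₂(t,z,i)·(ψ(s·(1+η(z)), i, y) − ψ(s,i,y)) dν(z). Consequently, if β₂ is continuous in t uniformly in (z,i), then t ↦ B(t) is continuous in the subordinate operator norm. -/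

import Mathlib

open MeasureTheory Set

/-- The weighted sup-norm `‖ψ‖_V = sup_{s>0, i, y>0} |ψ(s,i,y)| / (1+s)`. -/
noncomputable def normV {𝒳 : Type*} (ψ : ℝ → 𝒳 → ℝ → ℝ) : ℝ :=
  ⨆ p : Ioi (0 : ℝ) × 𝒳 × Ioi (0 : ℝ),
    |ψ (p.1 : ℝ) p.2.1 (p.2.2 : ℝ)| / (1 + (p.1 : ℝ))

/-- The operator `B(t)` of the paper:
`(B(t)ψ)(s,i,y) = ∫ β₂(t,z,i)·(ψ(s(1+η(z)),i,y) − ψ(s,i,y)) dν(z)`. -/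
noncomputable def Bop {𝒳 : Type*} (ν : Measure ℝ) (η : ℝ → ℝ) (β₂ : ℝ → ℝ → 𝒳 → ℝ)
    (t : ℝ) (ψ : ℝ → 𝒳 → ℝ → ℝ) : ℝ → 𝒳 → ℝ → ℝ :=
  fun s i y => ∫ z, β₂ t z i * (ψ (s * (1 + η z)) i y - ψ s i y) ∂ν

/-- A function `ψ` belongs to `V`: continuous on `(0,∞) × 𝒳 × (0,∞)`
with finite weighted sup-norm. -/
def memV {𝒳 : Type*} (ψ : ℝ → 𝒳 → ℝ → ℝ) : Prop :=
  (∀ i, ContinuousOn (fun q : ℝ × ℝ => ψ q.1 i q.2) (Ioi (0 : ℝ) ×ˢ Ioi (0 : ℝ))) ∧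
  BddAbove (Set.range fun p : Ioi (0 : ℝ) × 𝒳 × Ioi (0 : ℝ) =>
    |ψ (p.1 : ℝ) p.2.1 (p.2.2 : ℝ)| / (1 + (p.1 : ℝ)))

lemma normV_nonneg {𝒳 : Type*} (ψ : ℝ → 𝒳 → ℝ → ℝ) : 0 ≤ normV ψ :=
  Real.iSup_nonneg fun p => by
    have hp : (0 : ℝ) < p.1 := p.1.2
    positivity

lemma memV.abs_le {𝒳 : Type*} {ψ : ℝ → 𝒳 → ℝ → ℝ} (hψ : memV ψ) {s y : ℝ} (hs : 0 < s)
    (i : 𝒳) (hy : 0 < y) : |ψ s i y| ≤ normV ψ * (1 + s) := by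
  have h := le_ciSup hψ.2 (⟨s, hs⟩, i, ⟨y, hy⟩)
  exact (div_le_iff₀ (by positivity)).1 h

lemma normV_le {𝒳 : Type*} {ψ : ℝ → 𝒳 → ℝ → ℝ} {C : ℝ} (hC : 0 ≤ C)
    (h : ∀ s > 0, ∀ i, ∀ y > 0, |ψ s i y| ≤ C * (1 + s)) : normV ψ ≤ C := by
  refine Real.iSup_le (fun p => ?_) hC
  have hp : (0 : ℝ) < p.1 := p.1.2
  exact (div_le_iff₀ (by positivity)).2 (h _ hp _ _ p.2.2.2)

/-- The increment of `ψ` along a jump of relative size `h > -1`. -/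
lemma memV.abs_sub_le {𝒳 : Type*} {ψ : ℝ → 𝒳 → ℝ → ℝ} (hψ : memV ψ) {s y h : ℝ} (hs : 0 < s)
    (i : 𝒳) (hy : 0 < y) (hh : -1 < h) :
    |ψ (s * (1 + h)) i y - ψ s i y| ≤ normV ψ * (1 + s) * (3 + h) := by
  have h1 := hψ.abs_le (mul_pos hs (show 0 < 1 + h by linarith)) i hy
  have h2 := hψ.abs_le hs i hy
  have h3 := abs_sub (ψ (s * (1 + h)) i y) (ψ s i y)
  have h4 : 0 ≤ normV ψ * (1 + s + h) := mul_nonneg (normV_nonneg ψ) (by linarith)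
  linarith

lemma memV.continuous_comp_jump {𝒳 : Type*} {ψ : ℝ → 𝒳 → ℝ → ℝ} (hψ : memV ψ) {η : ℝ → ℝ}
    (hη : Continuous η) (hηlb : ∀ z, -1 < η z) {s y : ℝ} (hs : 0 < s) (i : 𝒳) (hy : 0 < y) :
    Continuous fun z => ψ (s * (1 + η z)) i y :=
  (hψ.1 i).comp_continuous (f := fun z => (s * (1 + η z), y)) (by fun_prop) fun z =>
    ⟨mul_pos hs (by linarith [hηlb z]), hy⟩

lemma memV.integrable_jump {𝒳 : Type*} {ψ : ℝ → 𝒳 → ℝ → ℝ} (hψ : memV ψ) {ν : Measure ℝ}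
    [IsFiniteMeasure ν] {η : ℝ → ℝ} (hη : Continuous η) (hηlb : ∀ z, -1 < η z)
    (hηint : Integrable η ν) {b : ℝ → ℝ} (hb : Continuous b) {M : ℝ} (hbM : ∀ z, |b z| ≤ M)
    {s y : ℝ} (hs : 0 < s) (i : 𝒳) (hy : 0 < y) :
    Integrable (fun z => b z * (ψ (s * (1 + η z)) i y - ψ s i y)) ν := by
  have hc := hψ.continuous_comp_jump hη hηlb hs i hy
  refine Integrable.bdd_mul (c := M) ?_ hb.aestronglyMeasurable (.of_forall hbM)
  refine Integrable.mono' (((integrable_const 3).add hηint).const_mul (normV ψ * (1 + s)))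
    (hc.sub continuous_const).aestronglyMeasurable (.of_forall fun z => ?_)
  exact hψ.abs_sub_le hs i hy (hηlb z)

lemma integrable_of_continuous_of_bdd {ν : Measure ℝ} [IsFiniteMeasure ν] {η : ℝ → ℝ}
    (hη : Continuous η) (hηbdd : ∃ M : ℝ, ∀ z, |η z| ≤ M) : Integrable η ν := by
  obtain ⟨M, hM⟩ := hηbdd
  exact Integrable.of_bound hη.aestronglyMeasurable M (.of_forall hM)

lemma integral_three_add {ν : Measure ℝ} [IsFiniteMeasure ν] {η : ℝ → ℝ}
    (hηint : Integrable η ν) :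
    ∫ z, (3 + η z) ∂ν = 3 * (ν Set.univ).toReal + ∫ z, η z ∂ν := by
  rw [integral_add (integrable_const 3) hηint, integral_const, smul_eq_mul, mul_comm]
  rfl

lemma three_mul_add_integral_nonneg {ν : Measure ℝ} [IsFiniteMeasure ν] {η : ℝ → ℝ}
    (hηint : Integrable η ν) (hηlb : ∀ z, -1 < η z) :
    0 ≤ 3 * (ν Set.univ).toReal + ∫ z, η z ∂ν := by
  rw [← integral_three_add hηint]
  exact integral_nonneg fun z => by
    have := hηlb z
    simp only [Pi.zero_apply]
    linarith

/-- The operator estimate for any common bound `S` of `|β₂ t - β₂ t'|`. -/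
lemma normV_Bop_sub_le {𝒳 : Type*} [Nonempty 𝒳] {ν : Measure ℝ} [IsFiniteMeasure ν]
    {η : ℝ → ℝ} (hη : Continuous η) (hηlb : ∀ z, -1 < η z) (hηint : Integrable η ν)
    {β₂ : ℝ → ℝ → 𝒳 → ℝ} {t t' M S : ℝ}
    (hc : ∀ i, Continuous fun z => β₂ t z i) (hc' : ∀ i, Continuous fun z => β₂ t' z i)
    (hM : ∀ z i, |β₂ t z i| ≤ M) (hM' : ∀ z i, |β₂ t' z i| ≤ M)
    (hS : ∀ z i, |β₂ t z i - β₂ t' z i| ≤ S) {ψ : ℝ → 𝒳 → ℝ → ℝ} (hψ : memV ψ) :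
    normV (fun s i y => Bop ν η β₂ t ψ s i y - Bop ν η β₂ t' ψ s i y) ≤
      S * (3 * (ν Set.univ).toReal + ∫ z, η z ∂ν) * normV ψ := by
  have hS0 : 0 ≤ S := (abs_nonneg _).trans (hS 0 (Classical.arbitrary 𝒳))
  refine normV_le (mul_nonneg (mul_nonneg hS0 (three_mul_add_integral_nonneg hηint hηlb))
    (normV_nonneg ψ)) fun s hs i y hy => ?_
  simp only [Bop]
  rw [← integral_sub
    (hψ.integrable_jump hη hηlb hηint (hc i) (fun z => hM z i) hs i hy)
    (hψ.integrable_jump hη hηlb hηint (hc' i) (fun z => hM' z i) hs i hy)]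
  calc |∫ z, (β₂ t z i * (ψ (s * (1 + η z)) i y - ψ s i y) -
          β₂ t' z i * (ψ (s * (1 + η z)) i y - ψ s i y)) ∂ν|
      ≤ ∫ z, S * (normV ψ * (1 + s)) * (3 + η z) ∂ν := by
        rw [← Real.norm_eq_abs]
        refine norm_integral_le_of_norm_le (((integrable_const 3).add hηint).const_mul _)
          (.of_forall fun z => ?_)
        rw [← sub_mul, Real.norm_eq_abs, abs_mul, mul_assoc]
        exact mul_le_mul (hS z i) (hψ.abs_sub_le hs i hy (hηlb z)) (abs_nonneg _) hS0
    _ = _ := by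
        rw [integral_const_mul, integral_three_add hηint]
        ring

/-- Lemma A.2 (second part): for all `t, t' ∈ [0,T]` and `ψ ∈ V`,
`‖B(t)ψ − B(t')ψ‖_V ≤ (sup_{z,i} |β₂(t,z,i) − β₂(t',z,i)|)·(3·ν(ℝ) + ∫ η dν)·‖ψ‖_V`;
consequently, if `β₂` is continuous in `t` uniformly in `(z,i)`, then `t ↦ B(t)` is
continuous in the subordinate operator norm. -/
theorem B_operator_norm_continuous {𝒳 : Type*} [Fintype 𝒳] [Nonempty 𝒳]
    (T : ℝ) (hT : 0 < T)
    (ν : Measure ℝ) [IsFiniteMeasure ν]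
    (η : ℝ → ℝ) (hηcont : Continuous η) (hηlb : ∀ z, -1 < η z)
    (hηbdd : ∃ M : ℝ, ∀ z, |η z| ≤ M)
    (β₂ : ℝ → ℝ → 𝒳 → ℝ)
    (hβcont : ∀ i, ContinuousOn (fun p : ℝ × ℝ => β₂ p.1 p.2 i)
      (Icc (0 : ℝ) T ×ˢ (univ : Set ℝ)))
    (hβbdd : ∃ M : ℝ, ∀ t ∈ Icc (0 : ℝ) T, ∀ (z : ℝ) (i : 𝒳), |β₂ t z i| ≤ M) :
    (∀ t ∈ Icc (0 : ℝ) T, ∀ t' ∈ Icc (0 : ℝ) T, ∀ ψ : ℝ → 𝒳 → ℝ → ℝ, memV ψ →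
      normV (fun s i y => Bop ν η β₂ t ψ s i y - Bop ν η β₂ t' ψ s i y) ≤
        (⨆ q : ℝ × 𝒳, |β₂ t q.1 q.2 - β₂ t' q.1 q.2|) *
          (3 * (ν Set.univ).toReal + ∫ z, η z ∂ν) * normV ψ) ∧
    ((∀ t ∈ Icc (0 : ℝ) T, ∀ ε > (0 : ℝ), ∃ δ > (0 : ℝ),
        ∀ t' ∈ Icc (0 : ℝ) T, |t' - t| < δ →
          ∀ (z : ℝ) (i : 𝒳), |β₂ t z i - β₂ t' z i| < ε) →
      ∀ t ∈ Icc (0 : ℝ) T, ∀ ε > (0 : ℝ), ∃ δ > (0 : ℝ),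
        ∀ t' ∈ Icc (0 : ℝ) T, |t' - t| < δ →
          ∀ ψ : ℝ → 𝒳 → ℝ → ℝ, memV ψ →
            normV (fun s i y => Bop ν η β₂ t ψ s i y - Bop ν η β₂ t' ψ s i y) ≤
              ε * normV ψ) := by
  obtain ⟨M, hM⟩ := hβbdd
  have hηint : Integrable η ν := integrable_of_continuous_of_bdd hηcont hηbdd
  have hc : ∀ t ∈ Icc (0 : ℝ) T, ∀ i, Continuous fun z => β₂ t z i := fun t ht i =>
    (hβcont i).comp_continuous (f := fun z => (t, z)) (by fun_prop) fun z => ⟨ht, mem_univ z⟩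
  refine ⟨fun t ht t' ht' ψ hψ => ?_, fun hunif t ht ε hε => ?_⟩
  · have hbdd : BddAbove (range fun q : ℝ × 𝒳 => |β₂ t q.1 q.2 - β₂ t' q.1 q.2|) := by
      refine ⟨M + M, ?_⟩
      rintro _ ⟨q, rfl⟩
      exact (abs_sub _ _).trans (add_le_add (hM t ht q.1 q.2) (hM t' ht' q.1 q.2))
    exact normV_Bop_sub_le hηcont hηlb hηint (hc t ht) (hc t' ht') (hM t ht) (hM t' ht')
      (fun z i => le_ciSup hbdd (z, i)) hψ
  · have hK := three_mul_add_integral_nonneg hηint hηlb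
    set K := 3 * (ν Set.univ).toReal + ∫ z, η z ∂ν with hK_def
    obtain ⟨δ, hδ, h⟩ := hunif t ht (ε / (K + 1)) (by positivity)
    refine ⟨δ, hδ, fun t' ht' htt ψ hψ => ?_⟩
    refine (normV_Bop_sub_le hηcont hηlb hηint (hc t ht) (hc t' ht') (hM t ht) (hM t' ht')
      (fun z i => (h t' ht' htt z i).le) hψ).trans ?_
    refine mul_le_mul_of_nonneg_right ?_ (normV_nonneg ψ)
    rw [← hK_def, div_mul_eq_mul_div, div_le_iff₀ (by positivity)]
    nlinarith
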